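/- For a, b ∈ ℂ with b not a nonpositive integer, and real x with |x| < 1/2: F₁(a; b, b; 3b; zx, z̄x) where z, z̄ are the complex numbers satisfying z + z̄ = 3 and z·z̄ = 3, equals (1−x)^{−a} · ₃F₂(a/3, (a+1)/3, (a+2)/3; b+1/3, b+2/3; (x/(x−1))³), assuming 3b, b+1/3, b+2/3 are not nonpositive integers. -/

import Mathlib

/-- The Pochhammer symbol `(a)_n = a(a+1)⋯(a+n-1)`. -/
noncomputable def poch (a : ℂ) (n : ℕ) : ℂ := Polynomial.eval a (ascPochhammer ℂ n)

/-- `z` is not a nonpositive integer. -/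
def NotNonposInt (z : ℂ) : Prop := ∀ m : ℕ, z ≠ -(m : ℂ)

/-- Appell's first function `F₁(a; b₁, b₂; c; x, y)`. -/
noncomputable def F1 (a b₁ b₂ c : ℂ) (x y : ℂ) : ℂ :=
  ∑' p : ℕ × ℕ,
    poch a (p.1 + p.2) / poch c (p.1 + p.2) *
      (poch b₁ p.1 * poch b₂ p.2) / ((Nat.factorial p.1) * (Nat.factorial p.2)) *
      x ^ p.1 * y ^ p.2

/-- The generalized hypergeometric series `₃F₂(a₁,a₂,a₃; c₁,c₂; x)`. -/
noncomputable def threeF2 (a₁ a₂ a₃ c₁ c₂ x : ℂ) : ℂ :=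
  ∑' k : ℕ, poch a₁ k * poch a₂ k * poch a₃ k /
    (poch c₁ k * poch c₂ k * (Nat.factorial k)) * x ^ k

open Finset Filter Topology

theorem poch_succ (a : ℂ) (n : ℕ) : poch a (n + 1) = poch a n * (a + n) :=
  ascPochhammer_succ_eval n a

theorem poch_add (a : ℂ) (m n : ℕ) : poch a (m + n) = poch a m * poch (a + m) n := by
  simp [poch, ← ascPochhammer_mul]

theorem poch_ne_zero {c : ℂ} (hc : NotNonposInt c) (n : ℕ) : poch c n ≠ 0 := by
  induction n with
  | zero => simp [poch]
  | succ n ih =>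
    rw [poch_succ]
    exact mul_ne_zero ih fun h => hc n (eq_neg_of_add_eq_zero_left h)

theorem poch_three_mul (a : ℂ) (k : ℕ) :
    poch a (3 * k) = 27 ^ k * (poch (a / 3) k * poch ((a + 1) / 3) k * poch ((a + 2) / 3) k) := by
  induction k with
  | zero => simp [poch]
  | succ k ih =>
    rw [show 3 * (k + 1) = 3 * k + 1 + 1 + 1 by ring]
    simp only [poch_succ, ih]
    push_cast
    ring

theorem poch_neg_natCast (N n : ℕ) :
    poch (-(N : ℂ)) n = (-1) ^ n * n.factorial * N.choose n := by
  rw [poch, ascPochhammer_eval_neg_eq_descPochhammer, descPochhammer_eval_eq_descFactorial,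
    Nat.descFactorial_eq_factorial_mul_choose]
  push_cast
  ring

theorem norm_poch_le (a : ℂ) (n : ℕ) :
    ‖poch a n‖ ≤ (ascPochhammer ℝ n).eval (‖a‖ + 1) := by
  induction n with
  | zero => simp [poch]
  | succ n ih =>
    rw [poch_succ, ascPochhammer_succ_eval, norm_mul]
    have h : ‖a + n‖ ≤ ‖a‖ + 1 + n := by
      refine (norm_add_le _ _).trans ?_
      simp
    gcongr
    exact (norm_nonneg _).trans ih

theorem hasSum_poch (a : ℂ) {x : ℂ} (hx : ‖x‖ < 1) :
    HasSum (fun n : ℕ => poch a n / n.factorial * x ^ n) ((1 - x) ^ (-a)) := by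
  have h := (Complex.one_div_one_sub_cpow_hasFPowerSeriesOnBall_zero a).hasSum (y := x)
    (by simpa [← ofReal_norm] using hx)
  rw [zero_add, one_div, ← Complex.cpow_neg] at h
  have hcoeff (n : ℕ) : Ring.choose (a + n - 1) n = poch a n / n.factorial := by
    have hn : (n.factorial : ℂ) ≠ 0 := by exact_mod_cast n.factorial_ne_zero
    have hm : (n.factorial : ℂ) * Ring.multichoose a n = poch a n := by
      rw [← nsmul_eq_mul, Ring.factorial_nsmul_multichoose_eq_ascPochhammer,
        Polynomial.ascPochhammer_smeval_eq_eval, poch]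
    rw [← hm, mul_div_cancel_left₀ _ hn, Ring.multichoose_eq]
  simpa only [FormalMultilinearSeries.ofScalars_apply_eq, hcoeff, smul_eq_mul] using h

theorem hasSum_ascPochhammer (a : ℝ) {r : ℝ} (hr0 : 0 ≤ r) (hr : r < 1) :
    HasSum (fun n : ℕ => (ascPochhammer ℝ n).eval a / n.factorial * r ^ n) ((1 - r) ^ (-a)) := by
  have h := hasSum_poch (a : ℂ) (x := (r : ℂ)) (by simpa [abs_of_nonneg hr0] using hr)
  rw [← Complex.hasSum_ofReal, Complex.ofReal_cpow (by linarith)]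
  push_cast
  convert h using 4 with n
  simp [poch, ← Complex.ofRealHom_eq_coe, ← Polynomial.eval_map_apply]

theorem exists_ascPochhammer_mul_pow_le (A : ℝ) (hA : 0 < A) {c : ℂ} (hc : NotNonposInt c) {t : ℝ}
    (ht0 : 0 < t) (ht : t < 1) :
    ∃ M : ℝ, ∀ n, (ascPochhammer ℝ n).eval A * t ^ n ≤ M * ‖poch c n‖ := by
  have hpos (n : ℕ) : 0 < ‖poch c n‖ := norm_pos_iff.2 (poch_ne_zero hc n)
  have hc' (n : ℕ) : ‖c + n‖ ≠ 0 :=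
    norm_ne_zero_iff.2 fun h => hc n (eq_neg_of_add_eq_zero_left h)
  have hlim : Tendsto (fun n : ℕ => (A + n) / ‖c + n‖ * t) atTop (𝓝 t) := by
    have h := (tendsto_add_mul_div_add_mul_atTop_nhds (A : ℂ) c 1 one_ne_zero).norm.mul_const t
    simp only [one_mul, div_one, norm_one, norm_div] at h
    refine h.congr fun n => ?_
    congr 2
    rw [← Complex.ofReal_natCast, ← Complex.ofReal_add, Complex.norm_of_nonneg (by positivity)]
  have hs : Summable fun n : ℕ => (ascPochhammer ℝ n).eval A * t ^ n / ‖poch c n‖ := by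
    refine summable_of_ratio_test_tendsto_lt_one ht (Eventually.of_forall fun n => ?_)
      (hlim.congr fun n => ?_)
    · have := ascPochhammer_pos n A hA
      have := hpos n
      positivity
    · have := ascPochhammer_pos n A hA
      have := hpos n
      have := hc' n
      rw [poch_succ, ascPochhammer_succ_eval, Real.norm_of_nonneg, Real.norm_of_nonneg, norm_mul]
      · field_simp
        ring
      all_goals positivity
  obtain ⟨M, hM⟩ := hs.tendsto_atTop_zero.bddAbove_range
  exact ⟨M, fun n => (div_le_iff₀ (hpos n)).1 (hM ⟨n, rfl⟩)⟩

theorem coeff_one_add_C_mul_X_pow (c : ℂ) (N n : ℕ) :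
    (((1 : Polynomial ℂ) + Polynomial.C c * Polynomial.X) ^ N).coeff n = N.choose n * c ^ n := by
  have h := Polynomial.comp_C_mul_X_coeff
    (p := (1 + Polynomial.X : Polynomial ℂ) ^ N) (r := c) (n := n)
  simpa [Polynomial.coeff_one_add_X_pow] using h

theorem sum_antidiagonal_poch_neg_natCast {z w : ℂ} (hzw : z + w = 3) (hzw' : z * w = 3)
    (n N : ℕ) :
    ∑ p ∈ antidiagonal n, poch (-(N : ℂ)) p.1 * poch (-(N : ℂ)) p.2 /
        (p.1.factorial * p.2.factorial) * z ^ p.1 * w ^ p.2 =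
      ∑ k ∈ range (n + 1), if 3 * k ≤ n then (-1) ^ k * poch (-(N : ℂ)) k / k.factorial *
        (poch (3 * -(N : ℂ) + 3 * k) (n - 3 * k) / (n - 3 * k).factorial) else 0 := by
  have hpoly : ((1 : Polynomial ℂ) + Polynomial.C (-z) * Polynomial.X) ^ N *
      (1 + Polynomial.C (-w) * Polynomial.X) ^ N =
      ∑ k ∈ range (N + 1), Polynomial.X ^ (3 * k) *
        ((1 + Polynomial.C (-1) * Polynomial.X) ^ (3 * (N - k)) * Polynomial.C (N.choose k : ℂ)) := by
    have h : ((1 : Polynomial ℂ) + Polynomial.C (-z) * Polynomial.X) *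
        (1 + Polynomial.C (-w) * Polynomial.X) =
        Polynomial.X ^ 3 + (1 + Polynomial.C (-1) * Polynomial.X) ^ 3 := by
      have h1 := congrArg Polynomial.C hzw
      have h2 := congrArg Polynomial.C hzw'
      simp only [map_add, map_mul, map_neg, map_one, map_ofNat] at *
      linear_combination (-Polynomial.X) * h1 + Polynomial.X ^ 2 * h2
    rw [← mul_pow, h, add_pow]
    refine sum_congr rfl fun k _ => ?_
    simp [pow_mul, mul_assoc]
  have hcoeff := congrArg (fun p => Polynomial.coeff p n) hpoly
  simp only [Polynomial.finsetSum_coeff, Polynomial.coeff_X_pow_mul',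
    Polynomial.coeff_mul_C] at hcoeff
  rw [Polynomial.coeff_mul] at hcoeff
  simp only [coeff_one_add_C_mul_X_pow] at hcoeff
  have hfac (m : ℕ) : (m.factorial : ℂ) ≠ 0 := by exact_mod_cast m.factorial_ne_zero
  calc
    _ = _ := ?_
    _ = _ := hcoeff
    _ = _ := ?_
  · refine sum_congr rfl fun p _ => ?_
    have := hfac p.1
    have := hfac p.2
    rw [poch_neg_natCast, poch_neg_natCast, neg_pow z, neg_pow w]
    field_simp
  · rw [sum_subset (range_subset_range.2 (show N + 1 ≤ N + n + 1 by omega)),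
      sum_subset (range_subset_range.2 (show n + 1 ≤ N + n + 1 by omega))]
    · refine sum_congr rfl fun k _ => ?_
      split_ifs with hk
      · rcases le_or_gt k N with hkN | hkN
        · have h : (3 * -(N : ℂ) + 3 * k) = -((3 * (N - k) : ℕ) : ℂ) := by
            push_cast [hkN]
            ring
          have := hfac k
          have := hfac (n - 3 * k)
          rw [h, poch_neg_natCast, poch_neg_natCast, ← mul_assoc, ← mul_assoc, ← mul_pow]
          field_simp
          simp
        · simp [poch_neg_natCast, Nat.choose_eq_zero_of_lt hkN]
      · rfl
    · intro k _ hk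
      rw [if_neg]
      simp at hk
      omega
    · intro k _ hk
      have h0 : N.choose k = 0 := Nat.choose_eq_zero_of_lt (by simpa using hk)
      simp [h0]

theorem sum_antidiagonal_poch (b : ℂ) {z w : ℂ} (hzw : z + w = 3) (hzw' : z * w = 3) (n : ℕ) :
    ∑ p ∈ antidiagonal n, poch b p.1 * poch b p.2 /
        (p.1.factorial * p.2.factorial) * z ^ p.1 * w ^ p.2 =
      ∑ k ∈ range (n + 1), if 3 * k ≤ n then (-1) ^ k * poch b k / k.factorial *
        (poch (3 * b + 3 * k) (n - 3 * k) / (n - 3 * k).factorial) else 0 := by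
  let P : Polynomial ℂ := ∑ p ∈ antidiagonal n, ascPochhammer ℂ p.1 * ascPochhammer ℂ p.2 *
    Polynomial.C ((p.1.factorial * p.2.factorial : ℂ)⁻¹ * z ^ p.1 * w ^ p.2)
  let Q : Polynomial ℂ := ∑ k ∈ range (n + 1), if 3 * k ≤ n then
    Polynomial.C ((-1) ^ k / (k.factorial : ℂ) / ((n - 3 * k).factorial : ℂ)) *
      ascPochhammer ℂ k * (ascPochhammer ℂ (n - 3 * k)).comp
        (Polynomial.C 3 * Polynomial.X + Polynomial.C (3 * (k : ℂ))) else 0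
  have hP (c : ℂ) : P.eval c = ∑ p ∈ antidiagonal n, poch c p.1 * poch c p.2 /
        (p.1.factorial * p.2.factorial) * z ^ p.1 * w ^ p.2 := by
    simp only [P, Polynomial.eval_finsetSum, Polynomial.eval_mul, Polynomial.eval_C, poch]
    exact sum_congr rfl fun p _ => by ring
  have hQ (c : ℂ) : Q.eval c = ∑ k ∈ range (n + 1), if 3 * k ≤ n then
      (-1) ^ k * poch c k / k.factorial *
        (poch (3 * c + 3 * k) (n - 3 * k) / (n - 3 * k).factorial) else 0 := by
    simp only [Q, Polynomial.eval_finsetSum]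
    refine sum_congr rfl fun k _ => ?_
    split_ifs
    · simp only [Polynomial.eval_mul, Polynomial.eval_C, Polynomial.eval_comp, Polynomial.eval_add,
        Polynomial.eval_X, poch]
      ring
    · simp
  have hPQ : P = Q := by
    refine Polynomial.eq_of_infinite_eval_eq P Q
      ((Set.infinite_range_of_injective (f := fun N : ℕ => -(N : ℂ)) fun _ _ h => ?_).mono ?_)
    · simpa using h
    · rintro _ ⟨N, rfl⟩
      exact (hP _).trans ((sum_antidiagonal_poch_neg_natCast hzw hzw' n N).trans (hQ _).symm)
  rw [← hP, ← hQ, hPQ]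

theorem tsum_antidiagonal {f : ℕ × ℕ → ℂ} (hf : Summable f) :
    ∑' p, f p = ∑' n, ∑ p ∈ antidiagonal n, f p := by
  conv_rhs => congr; ext; rw [← Finset.sum_finset_coe, ← tsum_fintype (L := .unconditional _)]
  rw [← HasAntidiagonal.sigmaAntidiagonalEquivProd.tsum_eq f]
  exact (HasAntidiagonal.sigmaAntidiagonalEquivProd.summable_iff.mpr hf).tsum_sigma'
    fun n => (hasSum_fintype _).summable

theorem tsum_three_mul_add {f : ℕ × ℕ → ℂ} (hf : Summable f) :
    ∑' p, f p = ∑' n, ∑ k ∈ range (n + 1), if 3 * k ≤ n then f (k, n - 3 * k) else 0 := by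
  let e : ℕ × ℕ → ℕ × ℕ := fun p => (3 * p.1 + p.2, p.1)
  let F : ℕ × ℕ → ℂ := fun p => if 3 * p.2 ≤ p.1 then f (p.2, p.1 - 3 * p.2) else 0
  have he : Function.Injective e := by
    rintro ⟨k, m⟩ ⟨k', m'⟩ h
    simp only [e, Prod.mk.injEq] at h ⊢
    omega
  have hFe : F ∘ e = f := by
    ext ⟨k, m⟩
    simp [F, e]
  have hF0 : ∀ p ∉ Set.range e, F p = 0 := by
    rintro ⟨n, k⟩ hp
    refine if_neg fun h => hp ⟨(k, n - 3 * k), ?_⟩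
    simp only [e, Prod.mk.injEq, and_true]
    exact Nat.add_sub_cancel' h
  have hF : Summable F := (he.summable_iff hF0).1 (hFe ▸ hf)
  have hsum : ∑' p, f p = ∑' p, F p := by
    rw [← he.tsum_eq (f := F) fun p hp => by_contra fun h => hp (hF0 p h), ← hFe]
    rfl
  rw [hsum, hF.tsum_prod]
  refine tsum_congr fun n => tsum_eq_sum fun k hk => if_neg ?_
  simp at hk ⊢
  omega

theorem summable_F1 (a b₁ b₂ : ℂ) {c u v : ℂ} (hc : NotNonposInt c) (hu : ‖u‖ < 1) (hv : ‖v‖ < 1) :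
    Summable fun p : ℕ × ℕ => poch a (p.1 + p.2) / poch c (p.1 + p.2) *
      (poch b₁ p.1 * poch b₂ p.2) / ((Nat.factorial p.1) * (Nat.factorial p.2)) *
      u ^ p.1 * v ^ p.2 := by
  obtain ⟨t, hmax, ht1⟩ := exists_between (max_lt hu hv)
  obtain ⟨hut, hvt⟩ := max_lt_iff.1 hmax
  have ht0 : 0 < t := (norm_nonneg u).trans_lt hut
  obtain ⟨M, hM⟩ := exists_ascPochhammer_mul_pow_le (‖a‖ + 1) (by positivity) hc ht0 ht1
  have hs (b : ℂ) {y : ℂ} (hy : ‖y‖ < t) := (hasSum_ascPochhammer (‖b‖ + 1)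
    (r := ‖y‖ / t) (by positivity) ((div_lt_one ht0).2 hy)).summable
  have hpos (b : ℂ) (n : ℕ) : 0 < (ascPochhammer ℝ n).eval (‖b‖ + 1) :=
    ascPochhammer_pos n _ (by positivity)
  refine Summable.of_norm_bounded
    (((hs b₁ hut).mul_of_nonneg (hs b₂ hvt) ?_ ?_).mul_left M) fun p => ?_
  · exact fun n => by have := hpos b₁ n; simp only [Pi.zero_apply]; positivity
  · exact fun n => by have := hpos b₂ n; simp only [Pi.zero_apply]; positivity
  · have hcp : 0 < ‖poch c (p.1 + p.2)‖ := norm_pos_iff.2 (poch_ne_zero hc _)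
    have hb : ‖poch a (p.1 + p.2)‖ / ‖poch c (p.1 + p.2)‖ ≤ M / t ^ (p.1 + p.2) := by
      rw [div_le_div_iff₀ hcp (by positivity)]
      refine le_trans ?_ (hM _)
      gcongr
      exact norm_poch_le a _
    have hM0 : 0 ≤ M / t ^ (p.1 + p.2) := le_trans (by positivity) hb
    have := hpos b₁ p.1
    have := hpos b₂ p.2
    simp only [norm_mul, norm_div, norm_pow, Complex.norm_natCast]
    calc _ ≤ M / t ^ (p.1 + p.2) * ((ascPochhammer ℝ p.1).eval (‖b₁‖ + 1) *
          (ascPochhammer ℝ p.2).eval (‖b₂‖ + 1)) / (p.1.factorial * p.2.factorial) *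
          ‖u‖ ^ p.1 * ‖v‖ ^ p.2 := by
          gcongr
          · exact norm_poch_le _ _
          · exact norm_poch_le _ _
      _ = _ := by
          rw [div_pow, div_pow, pow_add]
          field_simp

theorem summable_cubic (a : ℂ) {b x : ℂ} (h3b : NotNonposInt (3 * b)) (hx : ‖x‖ < 1 / 2) :
    Summable fun p : ℕ × ℕ => (-1) ^ p.1 * poch a (3 * p.1 + p.2) * poch b p.1 /
      (poch (3 * b) (3 * p.1) * p.1.factorial * p.2.factorial) * x ^ (3 * p.1 + p.2) := by
  set r := ‖x‖ with hr
  have hr0 : 0 ≤ r := norm_nonneg x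
  have hr1 : 0 < 1 - r := by linarith
  have hq : r / (1 - r) < 1 := by rw [div_lt_one hr1]; linarith
  obtain ⟨t, hqt, ht1⟩ := exists_between hq
  have ht0 : 0 < t := lt_of_le_of_lt (by positivity) hqt
  set A := ‖a‖ + 1 with hA
  have hA0 : 0 < A := by positivity
  obtain ⟨M, hM⟩ := exists_ascPochhammer_mul_pow_le A hA0 h3b ht0 ht1
  have hpos (α : ℝ) (hα : 0 < α) (n : ℕ) : 0 < (ascPochhammer ℝ n).eval α :=
    ascPochhammer_pos n _ hα
  have hc (n : ℕ) : 0 < ‖poch (3 * b) n‖ := norm_pos_iff.2 (poch_ne_zero h3b _)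
  let B := ‖b‖ + 1
  have hB0 : 0 < B := by positivity
  let C : ℕ → ℝ := fun k => (ascPochhammer ℝ (3 * k)).eval A * (ascPochhammer ℝ k).eval B /
    (‖poch (3 * b) (3 * k)‖ * k.factorial) * r ^ (3 * k)
  have hC (k : ℕ) : 0 ≤ C k := by
    have := hpos A hA0 (3 * k)
    have := hpos B hB0 k
    positivity
  let g : ℕ × ℕ → ℝ := fun p =>
    C p.1 * ((ascPochhammer ℝ p.2).eval (A + 3 * p.1) / p.2.factorial * r ^ p.2)
  have hg0 : 0 ≤ g := fun p => by
    have := hpos (A + 3 * p.1) (by positivity) p.2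
    have := hC p.1
    simp only [Pi.zero_apply, g]
    positivity
  have hin (k : ℕ) : HasSum (fun m => g (k, m)) (C k * (1 - r) ^ (-(A + 3 * k))) :=
    (hasSum_ascPochhammer (A + 3 * k) hr0 (by linarith)).mul_left _
  have hout : Summable fun k => C k * (1 - r) ^ (-(A + 3 * k)) := by
    have hq' : (r / (1 - r) / t) ^ 3 < 1 :=
      pow_lt_one₀ (by positivity) ((div_lt_one ht0).2 hqt) (by norm_num)
    refine Summable.of_nonneg_of_le (fun k => mul_nonneg (hC k) (by positivity)) (fun k => ?_)
      ((hasSum_ascPochhammer B (by positivity) hq').summable.mul_left (M * (1 - r) ^ (-A)))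
    have hb : (ascPochhammer ℝ (3 * k)).eval A / ‖poch (3 * b) (3 * k)‖ ≤ M / t ^ (3 * k) := by
      rw [div_le_div_iff₀ (hc _) (by positivity)]
      exact hM _
    have hrp : (1 - r) ^ (-(A + 3 * k)) = (1 - r) ^ (-A) / (1 - r) ^ (3 * k) := by
      rw [neg_add, ← sub_eq_add_neg, Real.rpow_sub hr1]
      congr 1
      exact_mod_cast Real.rpow_natCast (1 - r) (3 * k)
    have := hpos B hB0 k
    calc _ = (ascPochhammer ℝ (3 * k)).eval A / ‖poch (3 * b) (3 * k)‖ *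
          ((ascPochhammer ℝ k).eval B / k.factorial * r ^ (3 * k) *
            ((1 - r) ^ (-A) / (1 - r) ^ (3 * k))) := by
          rw [hrp]
          simp only [C]
          field_simp
      _ ≤ M / t ^ (3 * k) * ((ascPochhammer ℝ k).eval B / k.factorial * r ^ (3 * k) *
            ((1 - r) ^ (-A) / (1 - r) ^ (3 * k))) := by
          gcongr
      _ = _ := by
          rw [← pow_mul, div_pow, div_pow]
          field_simp
  refine Summable.of_norm_bounded ((summable_prod_of_nonneg hg0).2
    ⟨fun k => (hin k).summable, hout.congr fun k => (hin k).tsum_eq.symm⟩) fun p => ?_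
  have hadd : (ascPochhammer ℝ (3 * p.1 + p.2)).eval A =
      (ascPochhammer ℝ (3 * p.1)).eval A * (ascPochhammer ℝ p.2).eval (A + 3 * p.1) := by
    simp [← ascPochhammer_mul]
  have := hc (3 * p.1)
  simp only [norm_mul, norm_div, norm_pow, Complex.norm_natCast, norm_neg, norm_one, one_pow,
    one_mul, ← hr]
  calc _ ≤ (ascPochhammer ℝ (3 * p.1 + p.2)).eval A * (ascPochhammer ℝ p.1).eval B /
        (‖poch (3 * b) (3 * p.1)‖ * p.1.factorial * p.2.factorial) * r ^ (3 * p.1 + p.2) := by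
        gcongr
        · exact (hpos A hA0 _).le
        · exact norm_poch_le _ _
        · exact norm_poch_le _ _
    _ = _ := by
        rw [hadd, pow_add]
        simp only [g, C]
        field_simp

theorem cpow_neg_mul_threeF2 (a : ℂ) {b x : ℂ} (hb : NotNonposInt b) (h3b : NotNonposInt (3 * b))
    (hx : ‖x‖ < 1 / 2) :
    (1 - x) ^ (-a) * threeF2 (a / 3) ((a + 1) / 3) ((a + 2) / 3) (b + 1 / 3) (b + 2 / 3)
        ((x / (x - 1)) ^ 3) =
      ∑' p : ℕ × ℕ, (-1) ^ p.1 * poch a (3 * p.1 + p.2) * poch b p.1 /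
        (poch (3 * b) (3 * p.1) * p.1.factorial * p.2.factorial) * x ^ (3 * p.1 + p.2) := by
  have hx1 : 1 - x ≠ 0 := fun h => by
    rw [← sub_eq_zero.1 h, norm_one] at hx
    norm_num at hx
  rw [(summable_cubic a h3b hx).tsum_prod, threeF2, ← tsum_mul_left]
  refine tsum_congr fun k => ?_
  have hsum := ((hasSum_poch (a + 3 * k) (x := x) (by linarith)).mul_left
    ((-1) ^ k * poch a (3 * k) * poch b k / (poch (3 * b) (3 * k) * k.factorial) *
      x ^ (3 * k))).tsum_eq
  have hterm (m : ℕ) : (-1) ^ k * poch a (3 * k + m) * poch b k /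
        (poch (3 * b) (3 * k) * k.factorial * m.factorial) * x ^ (3 * k + m) =
      (-1) ^ k * poch a (3 * k) * poch b k / (poch (3 * b) (3 * k) * k.factorial) * x ^ (3 * k) *
        (poch (a + 3 * k) m / m.factorial * x ^ m) := by
    rw [poch_add, pow_add]
    push_cast
    ring
  simp only [hterm, hsum]
  have hcpow : (1 - x) ^ (-(a + 3 * k)) = (1 - x) ^ (-a) / (1 - x) ^ (3 * k) := by
    rw [neg_add, ← sub_eq_add_neg, Complex.cpow_sub _ _ hx1]
    congr 1
    exact_mod_cast Complex.cpow_natCast (1 - x) (3 * k)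
  have hfrac : ((x / (x - 1)) ^ 3) ^ k = (-1) ^ k * x ^ (3 * k) / (1 - x) ^ (3 * k) := by
    rw [pow_mul, pow_mul, ← mul_pow, ← div_pow]
    congr 1
    rw [← neg_sub 1 x, div_neg, Odd.neg_pow (by decide), div_pow]
    ring
  have hden := poch_three_mul (3 * b) k
  rw [mul_div_cancel_left₀ b three_ne_zero, show (3 * b + 1) / 3 = b + 1 / 3 by ring,
    show (3 * b + 2) / 3 = b + 2 / 3 by ring] at hden
  have h0 := poch_ne_zero h3b (3 * k)
  rw [hden] at h0
  have hbk := poch_ne_zero hb k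
  rw [hcpow, hfrac, hden, poch_three_mul a k]
  have h1 : poch (b + 1 / 3) k ≠ 0 := fun h => h0 (by rw [h]; ring)
  have h2 : poch (b + 2 / 3) k ≠ 0 := fun h => h0 (by rw [h]; ring)
  field_simp

theorem norm_sq_eq_three {z w : ℂ} (hzw : z + w = 3) (hzw' : z * w = 3) : ‖z‖ ^ 2 = 3 := by
  obtain rfl : w = 3 - z := by linear_combination hzw
  have hre := congrArg Complex.re hzw'
  have him := congrArg Complex.im hzw'
  simp at hre him
  rw [Complex.sq_norm, Complex.normSq_apply]
  have h : z.im * (3 - 2 * z.re) = 0 := by linear_combination him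
  rcases mul_eq_zero.1 h with h | h
  · nlinarith [sq_nonneg (2 * z.re - 3)]
  · have : z.re = 3 / 2 := by linarith
    rw [this] at hre ⊢
    linarith

theorem F1_to_threeF2 (a b : ℂ) (hb : NotNonposInt b) (h3b : NotNonposInt (3 * b))
    (hb1 : NotNonposInt (b + 1 / 3)) (hb2 : NotNonposInt (b + 2 / 3))
    (z w : ℂ) (hzw : z + w = 3) (hzw' : z * w = 3)
    (x : ℝ) (hx : |x| < 1 / 2) :
    F1 a b b (3 * b) (z * x) (w * x) =
      ((1 : ℂ) - x) ^ (-a) *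
        threeF2 (a / 3) ((a + 1) / 3) ((a + 2) / 3) (b + 1 / 3) (b + 2 / 3)
          (((x : ℂ) / ((x : ℂ) - 1)) ^ (3 : ℕ)) := by
  have hx' : ‖(x : ℂ)‖ < 1 / 2 := by simpa using hx
  have hlt {y : ℂ} (hy : ‖y‖ ^ 2 = 3) : ‖y * x‖ < 1 := by
    rw [norm_mul]
    have : ‖y‖ < 2 := by nlinarith [norm_nonneg y]
    nlinarith [norm_nonneg y, norm_nonneg (x : ℂ)]
  have hz := hlt (norm_sq_eq_three hzw hzw')
  have hw := hlt (norm_sq_eq_three ((add_comm w z).trans hzw) ((mul_comm w z).trans hzw'))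
  rw [cpow_neg_mul_threeF2 a hb h3b hx', tsum_three_mul_add (summable_cubic a h3b hx'), F1,
    tsum_antidiagonal (summable_F1 a b b h3b hz hw)]
  refine tsum_congr fun n => ?_
  calc _ = poch a n / poch (3 * b) n * x ^ n * ∑ p ∈ antidiagonal n, poch b p.1 * poch b p.2 /
        (p.1.factorial * p.2.factorial) * z ^ p.1 * w ^ p.2 := by
        rw [mul_sum]
        refine sum_congr rfl fun p hp => ?_
        rw [← mem_antidiagonal.1 hp]
        ring
    _ = _ := by
        rw [sum_antidiagonal_poch b hzw hzw', mul_sum]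
        refine sum_congr rfl fun k _ => ?_
        split_ifs with hk
        · obtain ⟨m, rfl⟩ := Nat.exists_eq_add_of_le hk
          have h0 := poch_ne_zero h3b (3 * k + m)
          rw [poch_add, mul_ne_zero_iff] at h0
          obtain ⟨h1, h2⟩ := h0
          rw [Nat.add_sub_cancel_left, poch_add (3 * b)]
          push_cast at h2 ⊢
          generalize poch (3 * b + 3 * k) m = P at h2 ⊢
          field_simp
        · simp
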